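/- The cube (X^3 - X + 1)^3 divides no Littlewood polynomial. -/

import Mathlib

open Polynomial

/-- A Littlewood polynomial: all coefficients of X^0,...,X^(deg) lie in {-1,1}. -/
def IsLittlewood (L : Polynomial ℤ) : Prop :=
  ∀ i ≤ L.natDegree, L.coeff i ∈ ({-1, 1} : Set ℤ)

lemma combine {u v w : ℝ} (h0 : u = 0) (h1 : v = 0) (h2 : w = 0) (m c : ℝ) :
    w + m * v + c * u = 0 := by
  rw [h0, h1, h2]; ring

lemma tail0 (n : ℕ) : ∑ x ∈ Finset.range n, (151/200 : ℝ)^x ≤ 200/49 := by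
  have h : ∑ x ∈ Finset.range n, (151/200 : ℝ)^x + 200/49 * (151/200)^n = 200/49 := by
    induction n with
    | zero => norm_num
    | succ k ih => rw [Finset.sum_range_succ, pow_succ]; linarith
  have : (0:ℝ) ≤ 200/49 * (151/200)^n := by positivity
  linarith

lemma tail1 (n : ℕ) : ∑ x ∈ Finset.range n, (x:ℝ) * (151/200 : ℝ)^x ≤ 30200/2401 := by
  have h : ∑ x ∈ Finset.range n, (x:ℝ) * (151/200 : ℝ)^x
      + (200/49 * n + 30200/2401) * (151/200)^n = 30200/2401 := by
    induction n with
    | zero => norm_num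
    | succ k ih =>
      rw [Finset.sum_range_succ, pow_succ]
      push_cast
      linear_combination ih
  have : (0:ℝ) ≤ (200/49 * n + 30200/2401) * (151/200)^n := by positivity
  linarith

lemma tail2 (n : ℕ) : ∑ x ∈ Finset.range n, (x:ℝ)^2 * (151/200 : ℝ)^x ≤ 10600200/117649 := by
  have h : ∑ x ∈ Finset.range n, (x:ℝ)^2 * (151/200 : ℝ)^x
      + (200/49 * n^2 + 60400/2401 * n + 10600200/117649) * (151/200)^n = 10600200/117649 := by
    induction n with
    | zero => norm_num
    | succ k ih =>
      rw [Finset.sum_range_succ, pow_succ]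
      push_cast
      linear_combination ih
  have : (0:ℝ) ≤ (200/49 * n^2 + 60400/2401 * n + 10600200/117649) * (151/200 : ℝ)^n := by
    positivity
  linarith

lemma tail_abs (y : ℝ) (hy0 : 0 < y) (hy1 : y ≤ 151/200) (b : ℕ → ℝ)
    (hb : ∀ i, |b i| ≤ y ^ i) (n j : ℕ) (B : ℝ)
    (hB : ∑ x ∈ Finset.range n, (x:ℝ)^j * (151/200 : ℝ)^x ≤ B) :
    |∑ x ∈ Finset.range n, (x:ℝ)^j * b (24 + x)| ≤ y^24 * B := by
  calc _ ≤ ∑ x ∈ Finset.range n, |(x:ℝ)^j * b (24 + x)| := Finset.abs_sum_le_sum_abs _ _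
    _ ≤ ∑ x ∈ Finset.range n, y^24 * ((x:ℝ)^j * (151/200 : ℝ)^x) := by
        apply Finset.sum_le_sum
        intro x _
        rw [abs_mul, abs_of_nonneg (by positivity : (0:ℝ) ≤ (x:ℝ)^j)]
        have h1 : |b (24 + x)| ≤ y^24 * (151/200 : ℝ)^x := by
          refine (hb _).trans ?_
          rw [pow_add]
          gcongr
        calc _ ≤ (x:ℝ)^j * (y^24 * (151/200 : ℝ)^x) := by gcongr
          _ = _ := by ring
    _ = y^24 * ∑ x ∈ Finset.range n, (x:ℝ)^j * (151/200 : ℝ)^x := by rw [Finset.mul_sum]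
    _ ≤ _ := by gcongr

lemma split_moment (b : ℕ → ℝ) (N j : ℕ) (h0 : ∀ i, N ≤ i → b i = 0)
    (h : ∑ i ∈ Finset.range N, (i:ℝ)^j * b i = 0) :
    ∑ i ∈ Finset.range 24, (i:ℝ)^j * b i + ∑ x ∈ Finset.range N, ((24 + x : ℕ):ℝ)^j * b (24 + x) = 0 := by
  rw [← Finset.sum_range_add (fun i => (i:ℝ)^j * b i), add_comm 24 N, Finset.sum_range_add, h, zero_add]
  apply Finset.sum_eq_zero
  intro x _
  rw [h0 _ (by omega), mul_zero]

set_option maxHeartbeats 4000000 in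
lemma core (y : ℝ) (hy0 : 0 < y) (hlo : 754877/1000000 ≤ y) (hhi : y ≤ 754878/1000000)
    (b : ℕ → ℝ) (N : ℕ) (hN : 1 ≤ N)
    (hb : ∀ i, i < N → b i = y ^ i ∨ b i = - y ^ i) (hb0 : ∀ i, N ≤ i → b i = 0)
    (hm : ∀ j, j ≤ 2 → ∑ i ∈ Finset.range N, (i:ℝ)^j * b i = 0) (h00 : b 0 = 1) : False := by
  have habs : ∀ i, |b i| ≤ y ^ i := by
    intro i
    by_cases hi : i < N
    · rcases hb i hi with h | h <;> rw [h] <;> simp [abs_of_pos hy0]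
    · rw [hb0 i (by omega)]; simp; positivity
  have e0 := split_moment b N 0 hb0 (hm 0 (by norm_num))
  have e1 := split_moment b N 1 hb0 (hm 1 (by norm_num))
  have e2 := split_moment b N 2 hb0 (hm 2 (by norm_num))
  have b0 := abs_le.1 (tail_abs y hy0 (by linarith) b habs N 0 _ (by simpa using tail0 N))
  have b1 := abs_le.1 (tail_abs y hy0 (by linarith) b habs N 1 _ (by simpa using tail1 N))
  have b2 := abs_le.1 (tail_abs y hy0 (by linarith) b habs N 2 _ (tail2 N))
  obtain ⟨t0, ht0⟩ : ∃ t, t = ∑ x ∈ Finset.range N, (x:ℝ)^0 * b (24 + x) := ⟨_, rfl⟩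
  obtain ⟨t1, ht1⟩ : ∃ t, t = ∑ x ∈ Finset.range N, (x:ℝ)^1 * b (24 + x) := ⟨_, rfl⟩
  obtain ⟨t2, ht2⟩ : ∃ t, t = ∑ x ∈ Finset.range N, (x:ℝ)^2 * b (24 + x) := ⟨_, rfl⟩
  have f0 : ∑ x ∈ Finset.range N, ((24 + x : ℕ):ℝ)^0 * b (24 + x) = t0 := by
    rw [ht0]; simp
  have f1 : ∑ x ∈ Finset.range N, ((24 + x : ℕ):ℝ)^1 * b (24 + x) = 24 * t0 + t1 := by
    rw [ht0, ht1, Finset.mul_sum, ← Finset.sum_add_distrib]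
    apply Finset.sum_congr rfl
    intro x _
    push_cast
    ring
  have f2 : ∑ x ∈ Finset.range N, ((24 + x : ℕ):ℝ)^2 * b (24 + x) = 576 * t0 + 48 * t1 + t2 := by
    rw [ht0, ht1, ht2, Finset.mul_sum, Finset.mul_sum, ← Finset.sum_add_distrib,
      ← Finset.sum_add_distrib]
    apply Finset.sum_congr rfl
    intro x _
    push_cast
    ring
  rw [f0] at e0
  rw [f1] at e1
  rw [f2] at e2
  rw [← ht0] at b0
  rw [← ht1] at b1
  rw [← ht2] at b2
  clear f0 f1 f2 ht0 ht1 ht2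
  have hz : ∀ k, ∑ i ∈ Finset.range k, b i ≠ 0 → k < N := by
    intro k hk
    by_contra hlt
    apply hk
    have h := hm 0 (by norm_num)
    simp only [pow_zero, one_mul] at h
    obtain ⟨m, rfl⟩ := Nat.exists_eq_add_of_le (not_lt.1 hlt)
    rw [Finset.sum_range_add, h, zero_add]
    exact Finset.sum_eq_zero (fun x _ => hb0 _ (by omega))
  have hz1 : ∀ k, ∑ i ∈ Finset.range k, (i:ℝ)^1 * b i ≠ 0 → k < N := by
    intro k hk
    by_contra hlt
    apply hk
    have h := hm 1 (by norm_num)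
    obtain ⟨m, rfl⟩ := Nat.exists_eq_add_of_le (not_lt.1 hlt)
    rw [Finset.sum_range_add, h, zero_add]
    exact Finset.sum_eq_zero (fun x _ => by rw [hb0 _ (by omega), mul_zero])
  have L : ∀ i, (754877/1000000)^i ≤ y^i := fun i => by gcongr
  have U : ∀ i, y^i ≤ (754878/1000000)^i := fun i => by gcongr
  simp only [Finset.sum_range_succ, Finset.sum_range_zero, pow_zero, pow_one, one_mul, zero_add] at e0 e1 e2
  norm_num at e0 e1 e2
  have l1 : 754877/1000000 ≤ y^1 := le_trans (by norm_num) (L 1)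
  have u1 : y^1 ≤ 754878/1000000 := le_trans (U 1) (by norm_num)
  have l2 : 569839/1000000 ≤ y^2 := le_trans (by norm_num) (L 2)
  have u2 : y^2 ≤ 569841/1000000 := le_trans (U 2) (by norm_num)
  have l3 : 430158/1000000 ≤ y^3 := le_trans (by norm_num) (L 3)
  have u3 : y^3 ≤ 430161/1000000 := le_trans (U 3) (by norm_num)
  have l4 : 324716/1000000 ≤ y^4 := le_trans (by norm_num) (L 4)
  have u4 : y^4 ≤ 324719/1000000 := le_trans (U 4) (by norm_num)
  have l5 : 245121/1000000 ≤ y^5 := le_trans (by norm_num) (L 5)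
  have u5 : y^5 ≤ 245123/1000000 := le_trans (U 5) (by norm_num)
  have l6 : 185036/1000000 ≤ y^6 := le_trans (by norm_num) (L 6)
  have u6 : y^6 ≤ 185038/1000000 := le_trans (U 6) (by norm_num)
  have l7 : 139679/1000000 ≤ y^7 := le_trans (by norm_num) (L 7)
  have u7 : y^7 ≤ 139682/1000000 := le_trans (U 7) (by norm_num)
  have l8 : 105441/1000000 ≤ y^8 := le_trans (by norm_num) (L 8)
  have u8 : y^8 ≤ 105443/1000000 := le_trans (U 8) (by norm_num)
  have l9 : 79594/1000000 ≤ y^9 := le_trans (by norm_num) (L 9)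
  have u9 : y^9 ≤ 79596/1000000 := le_trans (U 9) (by norm_num)
  have l10 : 60084/1000000 ≤ y^10 := le_trans (by norm_num) (L 10)
  have u10 : y^10 ≤ 60086/1000000 := le_trans (U 10) (by norm_num)
  have l11 : 45356/1000000 ≤ y^11 := le_trans (by norm_num) (L 11)
  have u11 : y^11 ≤ 45358/1000000 := le_trans (U 11) (by norm_num)
  have l12 : 34238/1000000 ≤ y^12 := le_trans (by norm_num) (L 12)
  have u12 : y^12 ≤ 34240/1000000 := le_trans (U 12) (by norm_num)
  have l13 : 25845/1000000 ≤ y^13 := le_trans (by norm_num) (L 13)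
  have u13 : y^13 ≤ 25847/1000000 := le_trans (U 13) (by norm_num)
  have l14 : 19510/1000000 ≤ y^14 := le_trans (by norm_num) (L 14)
  have u14 : y^14 ≤ 19511/1000000 := le_trans (U 14) (by norm_num)
  have l15 : 14727/1000000 ≤ y^15 := le_trans (by norm_num) (L 15)
  have u15 : y^15 ≤ 14729/1000000 := le_trans (U 15) (by norm_num)
  have l16 : 11117/1000000 ≤ y^16 := le_trans (by norm_num) (L 16)
  have u16 : y^16 ≤ 11119/1000000 := le_trans (U 16) (by norm_num)
  have l17 : 8392/1000000 ≤ y^17 := le_trans (by norm_num) (L 17)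
  have u17 : y^17 ≤ 8393/1000000 := le_trans (U 17) (by norm_num)
  have l18 : 6335/1000000 ≤ y^18 := le_trans (by norm_num) (L 18)
  have u18 : y^18 ≤ 6336/1000000 := le_trans (U 18) (by norm_num)
  have l19 : 4782/1000000 ≤ y^19 := le_trans (by norm_num) (L 19)
  have u19 : y^19 ≤ 4783/1000000 := le_trans (U 19) (by norm_num)
  have l20 : 3610/1000000 ≤ y^20 := le_trans (by norm_num) (L 20)
  have u20 : y^20 ≤ 3611/1000000 := le_trans (U 20) (by norm_num)
  have l21 : 2725/1000000 ≤ y^21 := le_trans (by norm_num) (L 21)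
  have u21 : y^21 ≤ 2726/1000000 := le_trans (U 21) (by norm_num)
  have l22 : 2057/1000000 ≤ y^22 := le_trans (by norm_num) (L 22)
  have u22 : y^22 ≤ 2058/1000000 := le_trans (U 22) (by norm_num)
  have l23 : 1552/1000000 ≤ y^23 := le_trans (by norm_num) (L 23)
  have u23 : y^23 ≤ 1553/1000000 := le_trans (U 23) (by norm_num)
  have l24 : 1172/1000000 ≤ y^24 := le_trans (by norm_num) (L 24)
  have u24 : y^24 ≤ 1173/1000000 := le_trans (U 24) (by norm_num)
  clear L U
  obtain ⟨p0, q0⟩ := b0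
  obtain ⟨p1, q1⟩ := b1
  obtain ⟨p2, q2⟩ := b2
  obtain ⟨c1, d1⟩ := abs_le.1 (habs 1)
  obtain ⟨c2, d2⟩ := abs_le.1 (habs 2)
  obtain ⟨c3, d3⟩ := abs_le.1 (habs 3)
  obtain ⟨c4, d4⟩ := abs_le.1 (habs 4)
  obtain ⟨c5, d5⟩ := abs_le.1 (habs 5)
  obtain ⟨c6, d6⟩ := abs_le.1 (habs 6)
  obtain ⟨c7, d7⟩ := abs_le.1 (habs 7)
  obtain ⟨c8, d8⟩ := abs_le.1 (habs 8)
  obtain ⟨c9, d9⟩ := abs_le.1 (habs 9)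
  obtain ⟨c10, d10⟩ := abs_le.1 (habs 10)
  obtain ⟨c11, d11⟩ := abs_le.1 (habs 11)
  obtain ⟨c12, d12⟩ := abs_le.1 (habs 12)
  obtain ⟨c13, d13⟩ := abs_le.1 (habs 13)
  obtain ⟨c14, d14⟩ := abs_le.1 (habs 14)
  obtain ⟨c15, d15⟩ := abs_le.1 (habs 15)
  obtain ⟨c16, d16⟩ := abs_le.1 (habs 16)
  obtain ⟨c17, d17⟩ := abs_le.1 (habs 17)
  obtain ⟨c18, d18⟩ := abs_le.1 (habs 18)
  obtain ⟨c19, d19⟩ := abs_le.1 (habs 19)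
  obtain ⟨c20, d20⟩ := abs_le.1 (habs 20)
  obtain ⟨c21, d21⟩ := abs_le.1 (habs 21)
  obtain ⟨c22, d22⟩ := abs_le.1 (habs 22)
  obtain ⟨c23, d23⟩ := abs_le.1 (habs 23)
  have n1 : 1 < N := by
    apply hz
    simp only [Finset.sum_range_succ, Finset.sum_range_zero, zero_add]
    apply ne_of_gt
    linarith only [h00]
  have g1 : b 1 = -y^1 := by
    rcases hb 1 n1 with h | h
    · exfalso
      have E := combine e0 e1 e2 (-17) 60
      linarith only [E, h, h00, l1, u1, l2, u2, l3, u3, l4, u4, l5, u5, l6, u6, l7, u7, l8, u8, l9, u9, l10, u10, l11, u11, l12, u12, l13, u13, l14, u14, l15, u15, l16, u16, l17, u17, l18, u18, l19, u19, l20, u20, l21, u21, l22, u22, l23, u23, l24, u24, c2, d2, c3, d3, c4, d4, c5, d5, c6, d6, c7, d7, c8, d8, c9, d9, c10, d10, c11, d11, c12, d12, c13, d13, c14, d14, c15, d15, c16, d16, c17, d17, c18, d18, c19, d19, c20, d20, c21, d21, c22, d22, c23, d23, p0, q0, p1, q1, p2, q2]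
    · exact h
  have n2 : 2 < N := by
    apply hz
    simp only [Finset.sum_range_succ, Finset.sum_range_zero, zero_add]
    apply ne_of_gt
    linarith only [h00, g1, l1, u1]
  have g2 : b 2 = -y^2 := by
    rcases hb 2 n2 with h | h
    · exfalso
      have E := combine e0 e1 e2 (-17) 60
      linarith only [E, h, h00, g1, l1, u1, l2, u2, l3, u3, l4, u4, l5, u5, l6, u6, l7, u7, l8, u8, l9, u9, l10, u10, l11, u11, l12, u12, l13, u13, l14, u14, l15, u15, l16, u16, l17, u17, l18, u18, l19, u19, l20, u20, l21, u21, l22, u22, l23, u23, l24, u24, c3, d3, c4, d4, c5, d5, c6, d6, c7, d7, c8, d8, c9, d9, c10, d10, c11, d11, c12, d12, c13, d13, c14, d14, c15, d15, c16, d16, c17, d17, c18, d18, c19, d19, c20, d20, c21, d21, c22, d22, c23, d23, p0, q0, p1, q1, p2, q2]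
    · exact h
  have n3 : 3 < N := by
    apply hz
    simp only [Finset.sum_range_succ, Finset.sum_range_zero, zero_add]
    apply ne_of_lt
    linarith only [h00, g1, l1, u1, g2, l2, u2]
  have g3 : b 3 = -y^3 := by
    rcases hb 3 n3 with h | h
    · exfalso
      have E := combine e0 e1 e2 (-18) 72
      linarith only [E, h, h00, g1, g2, l1, u1, l2, u2, l3, u3, l4, u4, l5, u5, l6, u6, l7, u7, l8, u8, l9, u9, l10, u10, l11, u11, l12, u12, l13, u13, l14, u14, l15, u15, l16, u16, l17, u17, l18, u18, l19, u19, l20, u20, l21, u21, l22, u22, l23, u23, l24, u24, c4, d4, c5, d5, c6, d6, c7, d7, c8, d8, c9, d9, c10, d10, c11, d11, c12, d12, c13, d13, c14, d14, c15, d15, c16, d16, c17, d17, c18, d18, c19, d19, c20, d20, c21, d21, c22, d22, c23, d23, p0, q0, p1, q1, p2, q2]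
    · exact h
  have n4 : 4 < N := by
    apply hz
    simp only [Finset.sum_range_succ, Finset.sum_range_zero, zero_add]
    apply ne_of_lt
    linarith only [h00, g1, l1, u1, g2, l2, u2, g3, l3, u3]
  have g4 : b 4 = y^4 := by
    rcases hb 4 n4 with h | h
    · exact h
    · exfalso
      have E := combine e0 e1 e2 (-26) 153
      linarith only [E, h, h00, g1, g2, g3, l1, u1, l2, u2, l3, u3, l4, u4, l5, u5, l6, u6, l7, u7, l8, u8, l9, u9, l10, u10, l11, u11, l12, u12, l13, u13, l14, u14, l15, u15, l16, u16, l17, u17, l18, u18, l19, u19, l20, u20, l21, u21, l22, u22, l23, u23, l24, u24, c5, d5, c6, d6, c7, d7, c8, d8, c9, d9, c10, d10, c11, d11, c12, d12, c13, d13, c14, d14, c15, d15, c16, d16, c17, d17, c18, d18, c19, d19, c20, d20, c21, d21, c22, d22, c23, d23, p0, q0, p1, q1, p2, q2]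
  have n5 : 5 < N := by
    apply hz
    simp only [Finset.sum_range_succ, Finset.sum_range_zero, zero_add]
    apply ne_of_lt
    linarith only [h00, g1, l1, u1, g2, l2, u2, g3, l3, u3, g4, l4, u4]
  have g5 : b 5 = y^5 := by
    rcases hb 5 n5 with h | h
    · exact h
    · exfalso
      have E := combine e0 e1 e2 (-27) 162
      linarith only [E, h, h00, g1, g2, g3, g4, l1, u1, l2, u2, l3, u3, l4, u4, l5, u5, l6, u6, l7, u7, l8, u8, l9, u9, l10, u10, l11, u11, l12, u12, l13, u13, l14, u14, l15, u15, l16, u16, l17, u17, l18, u18, l19, u19, l20, u20, l21, u21, l22, u22, l23, u23, l24, u24, c6, d6, c7, d7, c8, d8, c9, d9, c10, d10, c11, d11, c12, d12, c13, d13, c14, d14, c15, d15, c16, d16, c17, d17, c18, d18, c19, d19, c20, d20, c21, d21, c22, d22, c23, d23, p0, q0, p1, q1, p2, q2]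
  have n6 : 6 < N := by
    apply hz
    simp only [Finset.sum_range_succ, Finset.sum_range_zero, zero_add]
    apply ne_of_lt
    linarith only [h00, g1, l1, u1, g2, l2, u2, g3, l3, u3, g4, l4, u4, g5, l5, u5]
  have g6 : b 6 = y^6 := by
    rcases hb 6 n6 with h | h
    · exact h
    · exfalso
      have E := combine e0 e1 e2 (-29) 190
      linarith only [E, h, h00, g1, g2, g3, g4, g5, l1, u1, l2, u2, l3, u3, l4, u4, l5, u5, l6, u6, l7, u7, l8, u8, l9, u9, l10, u10, l11, u11, l12, u12, l13, u13, l14, u14, l15, u15, l16, u16, l17, u17, l18, u18, l19, u19, l20, u20, l21, u21, l22, u22, l23, u23, l24, u24, c7, d7, c8, d8, c9, d9, c10, d10, c11, d11, c12, d12, c13, d13, c14, d14, c15, d15, c16, d16, c17, d17, c18, d18, c19, d19, c20, d20, c21, d21, c22, d22, c23, d23, p0, q0, p1, q1, p2, q2]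
  have n7 : 7 < N := by
    apply hz1
    simp only [Finset.sum_range_succ, Finset.sum_range_zero, zero_add]
    push_cast
    apply ne_of_gt
    linarith only [h00, g1, l1, u1, g2, l2, u2, g3, l3, u3, g4, l4, u4, g5, l5, u5, g6, l6, u6]
  have g7 : b 7 = y^7 := by
    rcases hb 7 n7 with h | h
    · exact h
    · exfalso
      have E := combine e0 e1 e2 (-32) 231
      linarith only [E, h, h00, g1, g2, g3, g4, g5, g6, l1, u1, l2, u2, l3, u3, l4, u4, l5, u5, l6, u6, l7, u7, l8, u8, l9, u9, l10, u10, l11, u11, l12, u12, l13, u13, l14, u14, l15, u15, l16, u16, l17, u17, l18, u18, l19, u19, l20, u20, l21, u21, l22, u22, l23, u23, l24, u24, c8, d8, c9, d9, c10, d10, c11, d11, c12, d12, c13, d13, c14, d14, c15, d15, c16, d16, c17, d17, c18, d18, c19, d19, c20, d20, c21, d21, c22, d22, c23, d23, p0, q0, p1, q1, p2, q2]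
  have n8 : 8 < N := by
    apply hz
    simp only [Finset.sum_range_succ, Finset.sum_range_zero, zero_add]
    apply ne_of_gt
    linarith only [h00, g1, l1, u1, g2, l2, u2, g3, l3, u3, g4, l4, u4, g5, l5, u5, g6, l6, u6, g7, l7, u7]
  have g8 : b 8 = -y^8 := by
    rcases hb 8 n8 with h | h
    · exfalso
      have E := combine e0 e1 e2 (-29) 204
      linarith only [E, h, h00, g1, g2, g3, g4, g5, g6, g7, l1, u1, l2, u2, l3, u3, l4, u4, l5, u5, l6, u6, l7, u7, l8, u8, l9, u9, l10, u10, l11, u11, l12, u12, l13, u13, l14, u14, l15, u15, l16, u16, l17, u17, l18, u18, l19, u19, l20, u20, l21, u21, l22, u22, l23, u23, l24, u24, c9, d9, c10, d10, c11, d11, c12, d12, c13, d13, c14, d14, c15, d15, c16, d16, c17, d17, c18, d18, c19, d19, c20, d20, c21, d21, c22, d22, c23, d23, p0, q0, p1, q1, p2, q2]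
    · exact h
  have n9 : 9 < N := by
    apply hz
    simp only [Finset.sum_range_succ, Finset.sum_range_zero, zero_add]
    apply ne_of_gt
    linarith only [h00, g1, l1, u1, g2, l2, u2, g3, l3, u3, g4, l4, u4, g5, l5, u5, g6, l6, u6, g7, l7, u7, g8, l8, u8]
  have g9 : b 9 = -y^9 := by
    rcases hb 9 n9 with h | h
    · exfalso
      have E := combine e0 e1 e2 (-30) 221
      linarith only [E, h, h00, g1, g2, g3, g4, g5, g6, g7, g8, l1, u1, l2, u2, l3, u3, l4, u4, l5, u5, l6, u6, l7, u7, l8, u8, l9, u9, l10, u10, l11, u11, l12, u12, l13, u13, l14, u14, l15, u15, l16, u16, l17, u17, l18, u18, l19, u19, l20, u20, l21, u21, l22, u22, l23, u23, l24, u24, c10, d10, c11, d11, c12, d12, c13, d13, c14, d14, c15, d15, c16, d16, c17, d17, c18, d18, c19, d19, c20, d20, c21, d21, c22, d22, c23, d23, p0, q0, p1, q1, p2, q2]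
    · exact h
  have n10 : 10 < N := by
    apply hz
    simp only [Finset.sum_range_succ, Finset.sum_range_zero, zero_add]
    apply ne_of_lt
    linarith only [h00, g1, l1, u1, g2, l2, u2, g3, l3, u3, g4, l4, u4, g5, l5, u5, g6, l6, u6, g7, l7, u7, g8, l8, u8, g9, l9, u9]
  have g10 : b 10 = y^10 := by
    rcases hb 10 n10 with h | h
    · exact h
    · exfalso
      have E := combine e0 e1 e2 (-37) 322
      linarith only [E, h, h00, g1, g2, g3, g4, g5, g6, g7, g8, g9, l1, u1, l2, u2, l3, u3, l4, u4, l5, u5, l6, u6, l7, u7, l8, u8, l9, u9, l10, u10, l11, u11, l12, u12, l13, u13, l14, u14, l15, u15, l16, u16, l17, u17, l18, u18, l19, u19, l20, u20, l21, u21, l22, u22, l23, u23, l24, u24, c11, d11, c12, d12, c13, d13, c14, d14, c15, d15, c16, d16, c17, d17, c18, d18, c19, d19, c20, d20, c21, d21, c22, d22, c23, d23, p0, q0, p1, q1, p2, q2]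
  have n11 : 11 < N := by
    apply hz
    simp only [Finset.sum_range_succ, Finset.sum_range_zero, zero_add]
    apply ne_of_gt
    linarith only [h00, g1, l1, u1, g2, l2, u2, g3, l3, u3, g4, l4, u4, g5, l5, u5, g6, l6, u6, g7, l7, u7, g8, l8, u8, g9, l9, u9, g10, l10, u10]
  have g11 : b 11 = y^11 := by
    rcases hb 11 n11 with h | h
    · exact h
    · exfalso
      have E := combine e0 e1 e2 (-38) 336
      linarith only [E, h, h00, g1, g2, g3, g4, g5, g6, g7, g8, g9, g10, l1, u1, l2, u2, l3, u3, l4, u4, l5, u5, l6, u6, l7, u7, l8, u8, l9, u9, l10, u10, l11, u11, l12, u12, l13, u13, l14, u14, l15, u15, l16, u16, l17, u17, l18, u18, l19, u19, l20, u20, l21, u21, l22, u22, l23, u23, l24, u24, c12, d12, c13, d13, c14, d14, c15, d15, c16, d16, c17, d17, c18, d18, c19, d19, c20, d20, c21, d21, c22, d22, c23, d23, p0, q0, p1, q1, p2, q2]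
  have n12 : 12 < N := by
    apply hz
    simp only [Finset.sum_range_succ, Finset.sum_range_zero, zero_add]
    apply ne_of_gt
    linarith only [h00, g1, l1, u1, g2, l2, u2, g3, l3, u3, g4, l4, u4, g5, l5, u5, g6, l6, u6, g7, l7, u7, g8, l8, u8, g9, l9, u9, g10, l10, u10, g11, l11, u11]
  have g12 : b 12 = -y^12 := by
    rcases hb 12 n12 with h | h
    · exfalso
      have E := combine e0 e1 e2 (-40) 396
      linarith only [E, h, h00, g1, g2, g3, g4, g5, g6, g7, g8, g9, g10, g11, l1, u1, l2, u2, l3, u3, l4, u4, l5, u5, l6, u6, l7, u7, l8, u8, l9, u9, l10, u10, l11, u11, l12, u12, l13, u13, l14, u14, l15, u15, l16, u16, l17, u17, l18, u18, l19, u19, l20, u20, l21, u21, l22, u22, l23, u23, l24, u24, c13, d13, c14, d14, c15, d15, c16, d16, c17, d17, c18, d18, c19, d19, c20, d20, c21, d21, c22, d22, c23, d23, p0, q0, p1, q1, p2, q2]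
    · exact h
  have n13 : 13 < N := by
    apply hz
    simp only [Finset.sum_range_succ, Finset.sum_range_zero, zero_add]
    apply ne_of_gt
    linarith only [h00, g1, l1, u1, g2, l2, u2, g3, l3, u3, g4, l4, u4, g5, l5, u5, g6, l6, u6, g7, l7, u7, g8, l8, u8, g9, l9, u9, g10, l10, u10, g11, l11, u11, g12, l12, u12]
  have g13 : b 13 = y^13 := by
    rcases hb 13 n13 with h | h
    · exact h
    · exfalso
      have E := combine e0 e1 e2 (-40) 384
      linarith only [E, h, h00, g1, g2, g3, g4, g5, g6, g7, g8, g9, g10, g11, g12, l1, u1, l2, u2, l3, u3, l4, u4, l5, u5, l6, u6, l7, u7, l8, u8, l9, u9, l10, u10, l11, u11, l12, u12, l13, u13, l14, u14, l15, u15, l16, u16, l17, u17, l18, u18, l19, u19, l20, u20, l21, u21, l22, u22, l23, u23, l24, u24, c14, d14, c15, d15, c16, d16, c17, d17, c18, d18, c19, d19, c20, d20, c21, d21, c22, d22, c23, d23, p0, q0, p1, q1, p2, q2]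
  have n14 : 14 < N := by
    apply hz
    simp only [Finset.sum_range_succ, Finset.sum_range_zero, zero_add]
    apply ne_of_gt
    linarith only [h00, g1, l1, u1, g2, l2, u2, g3, l3, u3, g4, l4, u4, g5, l5, u5, g6, l6, u6, g7, l7, u7, g8, l8, u8, g9, l9, u9, g10, l10, u10, g11, l11, u11, g12, l12, u12, g13, l13, u13]
  have g14 : b 14 = -y^14 := by
    rcases hb 14 n14 with h | h
    · exfalso
      have E := combine e0 e1 e2 (-45) 504
      linarith only [E, h, h00, g1, g2, g3, g4, g5, g6, g7, g8, g9, g10, g11, g12, g13, l1, u1, l2, u2, l3, u3, l4, u4, l5, u5, l6, u6, l7, u7, l8, u8, l9, u9, l10, u10, l11, u11, l12, u12, l13, u13, l14, u14, l15, u15, l16, u16, l17, u17, l18, u18, l19, u19, l20, u20, l21, u21, l22, u22, l23, u23, l24, u24, c15, d15, c16, d16, c17, d17, c18, d18, c19, d19, c20, d20, c21, d21, c22, d22, c23, d23, p0, q0, p1, q1, p2, q2]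
    · exact h
  have n15 : 15 < N := by
    apply hz
    simp only [Finset.sum_range_succ, Finset.sum_range_zero, zero_add]
    apply ne_of_gt
    linarith only [h00, g1, l1, u1, g2, l2, u2, g3, l3, u3, g4, l4, u4, g5, l5, u5, g6, l6, u6, g7, l7, u7, g8, l8, u8, g9, l9, u9, g10, l10, u10, g11, l11, u11, g12, l12, u12, g13, l13, u13, g14, l14, u14]
  rcases hb 15 n15 with h | h
  · skip
    have E := combine e0 e1 e2 (-24) 0
    linarith only [E, h, h00, g1, g2, g3, g4, g5, g6, g7, g8, g9, g10, g11, g12, g13, g14, l1, u1, l2, u2, l3, u3, l4, u4, l5, u5, l6, u6, l7, u7, l8, u8, l9, u9, l10, u10, l11, u11, l12, u12, l13, u13, l14, u14, l15, u15, l16, u16, l17, u17, l18, u18, l19, u19, l20, u20, l21, u21, l22, u22, l23, u23, l24, u24, c16, d16, c17, d17, c18, d18, c19, d19, c20, d20, c21, d21, c22, d22, c23, d23, p0, q0, p1, q1, p2, q2]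
  · skip
    have E := combine e0 e1 e2 (-41) 408
    linarith only [E, h, h00, g1, g2, g3, g4, g5, g6, g7, g8, g9, g10, g11, g12, g13, g14, l1, u1, l2, u2, l3, u3, l4, u4, l5, u5, l6, u6, l7, u7, l8, u8, l9, u9, l10, u10, l11, u11, l12, u12, l13, u13, l14, u14, l15, u15, l16, u16, l17, u17, l18, u18, l19, u19, l20, u20, l21, u21, l22, u22, l23, u23, l24, u24, c16, d16, c17, d17, c18, d18, c19, d19, c20, d20, c21, d21, c22, d22, c23, d23, p0, q0, p1, q1, p2, q2]

lemma exists_root : ∃ y : ℝ, 754877/1000000 ≤ y ∧ y ≤ 754878/1000000 ∧ y^3 + y^2 = 1 := by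
  have hc : ContinuousOn (fun y : ℝ => y^3 + y^2) (Set.Icc (754877/1000000) (754878/1000000)) := by
    fun_prop
  have h := intermediate_value_Icc (by norm_num) hc
  have hm : (1:ℝ) ∈ Set.Icc ((754877/1000000 : ℝ)^3 + (754877/1000000 : ℝ)^2)
      ((754878/1000000 : ℝ)^3 + (754878/1000000 : ℝ)^2) := by
    constructor <;> norm_num
  obtain ⟨y, hy, hy2⟩ := h hm
  exact ⟨y, hy.1, hy.2, hy2⟩

/-- Moments of a polynomial at a triple root. -/
lemma moments (P : Polynomial ℝ) (a : ℝ) (n : ℕ) (hn : P.natDegree < n)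
    (f h : Polynomial ℝ) (hP : P = f ^ 3 * h) (ha : f.eval a = 0) (j : ℕ) (hj : j ≤ 2) :
    ∑ i ∈ Finset.range n, (i:ℝ)^j * (P.coeff i * a ^ i) = 0 := by
  have key : ∀ Q : Polynomial ℝ, Q.natDegree < n →
      (X * derivative Q).natDegree < n ∧ ∀ i, (X * derivative Q).coeff i = i * Q.coeff i := by
    intro Q hQ
    have hc : ∀ i, (X * derivative Q).coeff i = i * Q.coeff i := by
      intro i
      cases i with
      | zero => simp
      | succ k => rw [coeff_X_mul, coeff_derivative]; push_cast; ring
    refine ⟨lt_of_le_of_lt ?_ hQ, hc⟩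
    rw [natDegree_le_iff_coeff_eq_zero]
    intro i hi
    rw [hc, coeff_eq_zero_of_natDegree_lt hi, mul_zero]
  obtain ⟨k1, k1'⟩ := key P hn
  obtain ⟨k2, k2'⟩ := key _ k1
  have r0 : P.eval a = 0 := by rw [hP]; simp [ha]
  have r1 : (X * derivative P).eval a = 0 := by rw [hP]; simp [ha, derivative_pow]
  have r2 : (X * derivative (X * derivative P)).eval a = 0 := by
    rw [hP]; simp [ha, derivative_pow]
  rw [eval_eq_sum_range' hn] at r0
  rw [eval_eq_sum_range' k1] at r1
  rw [eval_eq_sum_range' k2] at r2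
  interval_cases j
  · simpa using r0
  · rw [← r1]
    apply Finset.sum_congr rfl
    intro i _
    rw [k1']; ring
  · rw [← r2]
    apply Finset.sum_congr rfl
    intro i _
    rw [k2', k1']; ring

/-- The cube `(X^3 - X + 1)^3` divides no Littlewood polynomial. -/
theorem cube_no_littlewood :
    ¬ ∃ L : Polynomial ℤ, IsLittlewood L ∧ ((X ^ 3 - X + 1 : Polynomial ℤ) ^ 3) ∣ L := by
  rintro ⟨L, hL, h, hh⟩
  obtain ⟨y, hlo, hhi, hy⟩ := exists_root
  have hy0 : 0 < y := by linarith
  set d := L.natDegree with hd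
  set P : Polynomial ℝ := L.map (Int.castRingHom ℝ) with hPdef
  have hPd : P.natDegree < d + 1 := Nat.lt_succ_of_le natDegree_map_le
  have hPe : P = (X ^ 3 - X + 1) ^ 3 * h.map (Int.castRingHom ℝ) := by
    rw [hPdef, hh]; simp [Polynomial.map_mul, Polynomial.map_pow]
  set a : ℝ := -y⁻¹ with ha
  have hay : a * (-y) = 1 := by rw [ha]; field_simp
  have ha0 : a ≠ 0 := by rintro h0; rw [h0] at hay; simp at hay
  have hroot : (X ^ 3 - X + 1 : Polynomial ℝ).eval a = 0 := by
    simp only [eval_add, eval_sub, eval_pow, eval_X, eval_one]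
    rw [ha]; field_simp
    linear_combination hy
  have hmom := moments P a (d+1) hPd _ _ hPe hroot
  let b : ℕ → ℝ := fun i => if i < d + 1 then P.coeff (d - i) * (-y)^i else 0
  have hbe : ∀ i, i < d + 1 → b i = P.coeff (d - i) * (-y)^i := fun i hi => if_pos hi
  have hb0 : ∀ i, d + 1 ≤ i → b i = 0 := fun i hi => if_neg (by omega)
  have hcoef : ∀ i, i ≤ d → P.coeff i = -1 ∨ P.coeff i = 1 := by
    intro i hi
    have := hL i hi
    simp only [Set.mem_insert_iff, Set.mem_singleton_iff] at this
    rw [hPdef, coeff_map]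
    rcases this with h | h <;> rw [h] <;> simp
  have hb : ∀ i, i < d + 1 → b i = y ^ i ∨ b i = - y ^ i := by
    intro i hi
    rw [hbe i hi]
    rcases hcoef (d - i) (by omega) with h | h <;> rcases neg_one_pow_eq_or ℝ i with h' | h' <;>
      rw [h, neg_pow y, h'] <;> simp
  -- reflected moments
  have hrefl : ∀ j, j ≤ 2 → ∑ i ∈ Finset.range (d+1), ((d:ℝ) - i)^j * b i = 0 := by
    intro j hj
    have h1 := hmom j hj
    rw [← Finset.sum_range_reflect] at h1
    have h2 : a ^ d * ∑ i ∈ Finset.range (d+1), ((d:ℝ) - i)^j * b i = 0 := by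
      rw [← h1, Finset.mul_sum]
      apply Finset.sum_congr rfl
      intro i hi
      have hi' : i < d + 1 := Finset.mem_range.1 hi
      have e : d + 1 - 1 - i = d - i := by omega
      rw [hbe i hi', e, Nat.cast_sub (by omega)]
      have : a ^ d * (-y)^i = a ^ (d - i) := by
        conv_lhs => rw [← Nat.sub_add_cancel (show i ≤ d by omega)]
        rw [pow_add, mul_assoc, ← mul_pow, hay, one_pow, mul_one]
      rw [← this]; ring
    exact (mul_eq_zero.1 h2).resolve_left (pow_ne_zero _ ha0)
  have s0 := hrefl 0 (by norm_num)
  have s1 := hrefl 1 (by norm_num)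
  have s2 := hrefl 2 (by norm_num)
  have m0 : ∑ i ∈ Finset.range (d+1), (i:ℝ)^0 * b i = 0 := by simpa using s0
  have m1 : ∑ i ∈ Finset.range (d+1), (i:ℝ)^1 * b i = 0 := by
    have : ∑ i ∈ Finset.range (d+1), ((d:ℝ) - i)^1 * b i
        = d * ∑ i ∈ Finset.range (d+1), (i:ℝ)^0 * b i - ∑ i ∈ Finset.range (d+1), (i:ℝ)^1 * b i := by
      rw [Finset.mul_sum, ← Finset.sum_sub_distrib]
      exact Finset.sum_congr rfl (fun i _ => by ring)
    rw [s1, m0] at this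
    linarith
  have m2 : ∑ i ∈ Finset.range (d+1), (i:ℝ)^2 * b i = 0 := by
    have : ∑ i ∈ Finset.range (d+1), ((d:ℝ) - i)^2 * b i
        = d^2 * ∑ i ∈ Finset.range (d+1), (i:ℝ)^0 * b i
          - 2 * d * ∑ i ∈ Finset.range (d+1), (i:ℝ)^1 * b i
          + ∑ i ∈ Finset.range (d+1), (i:ℝ)^2 * b i := by
      rw [Finset.mul_sum, Finset.mul_sum, ← Finset.sum_sub_distrib, ← Finset.sum_add_distrib]
      exact Finset.sum_congr rfl (fun i _ => by ring)
    rw [s2, m0, m1] at this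
    linarith
  have hm : ∀ j, j ≤ 2 → ∑ i ∈ Finset.range (d+1), (i:ℝ)^j * b i = 0 := by
    intro j hj
    interval_cases j
    · exact m0
    · exact m1
    · exact m2
  rcases hb 0 (by omega) with h | h
  · exact core y hy0 hlo hhi b (d+1) (by omega) hb hb0 hm (by simpa using h)
  · refine core y hy0 hlo hhi (fun i => - b i) (d+1) (by omega) ?_ ?_ ?_ ?_
    · intro i hi
      rcases hb i hi with h | h
      · right; simp [h]
      · left; simp [h]
    · intro i hi
      simp [hb0 i hi]
    · intro j hj
      have := hm j hj
      simp only [mul_neg, Finset.sum_neg_distrib, this, neg_zero]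
    · simp [h]
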